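/- arXiv:1606.07033 — 3 statements merged into one kernel-verified Lean document; each statement's English description precedes it below -/
import Mathlib

section
/- Let a ∈ 𝔓₂ be a word with Σ(a) = 1 or Σ(a) = −1. Then for every integer t, ρ^t(a) = a if and only if |a| divides t. -/
/-- Integer-indexed cyclic rotation `ρ^t` of a list. -/
def zrot (l : List ℤ) (t : ℤ) : List ℤ := l.rotate (t % (l.length : ℤ)).toNat

/-- Commuting words have proportional sums and lengths. -/
theorem List.length_mul_sum_eq_of_append_comm (u v : List ℤ) (h : u ++ v = v ++ u) :
    (u.length : ℤ) * v.sum = v.length * u.sum := by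
  by_cases hu : u = []
  · simp [hu]
  by_cases hv : v = []
  · simp [hv]
  have hu' := List.length_pos_iff.2 hu
  have hv' := List.length_pos_iff.2 hv
  rcases List.append_eq_append_iff.1 h with ⟨c, rfl, -⟩ | ⟨c, rfl, -⟩
  · have hc : u ++ c = c ++ u := by simpa using h
    have ih := List.length_mul_sum_eq_of_append_comm u c hc
    simp only [List.sum_append, List.length_append]
    push_cast
    linarith
  · have hc : c ++ v = v ++ c := by simpa using h
    have ih := List.length_mul_sum_eq_of_append_comm c v hc
    simp only [List.sum_append, List.length_append]
    push_cast
    linarith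
termination_by u.length + v.length
decreasing_by all_goals subst_vars; simp only [List.length_append] at *; omega

/-- If rotation by `k` fixes a word, its length divides `k` times its sum. -/
theorem List.length_dvd_mul_sum_of_rotate_eq_self {a : List ℤ} {k : ℕ} (hk : k ≤ a.length)
    (h : a.rotate k = a) : (a.length : ℤ) ∣ k * a.sum := by
  rw [List.rotate_eq_drop_append_take hk] at h
  have hc := List.length_mul_sum_eq_of_append_comm (a.take k) (a.drop k)
    ((List.take_append_drop k a).trans h.symm)
  have hsum := congrArg List.sum (List.take_append_drop k a)
  rw [List.sum_append] at hsum
  rw [List.length_take, List.length_drop, min_eq_left hk, Nat.cast_sub hk] at hc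
  exact ⟨(a.take k).sum, by rw [← hsum]; linarith⟩

/-- If `a ∈ 𝔓₂` has `Σ(a) = ±1`, then `ρ^t(a) = a` iff `|a|` divides `t`. -/
theorem stmt1 (a : List ℤ) (ha : a ≠ []) (hw : ∀ v ∈ a, v = 1 ∨ v = -1)
    (hs : a.sum = 1 ∨ a.sum = -1) (t : ℤ) :
    zrot a t = a ↔ (a.length : ℤ) ∣ t := by
  have hpos : (0 : ℤ) < a.length := by exact_mod_cast List.length_pos_iff.2 ha
  have hnonneg := Int.emod_nonneg t hpos.ne'
  have hlt := Int.emod_lt_of_pos t hpos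
  constructor
  · intro h
    have hd := List.length_dvd_mul_sum_of_rotate_eq_self (a := a)
      (k := (t % (a.length : ℤ)).toNat) (by omega) h
    rw [Int.toNat_of_nonneg hnonneg] at hd
    have hd' : (a.length : ℤ) ∣ t % a.length := by
      rcases hs with hs | hs <;> simpa [hs] using hd
    exact Int.dvd_of_emod_eq_zero (Int.eq_zero_of_dvd_of_nonneg_of_lt hnonneg hlt hd')
  · intro h
    simp [zrot, Int.emod_eq_zero_of_dvd h]
end

section
/- Let b₁, b₂ ∈ 𝔓₂ be words of the same odd length m with Σ(b₁) = ±1, and let s, r be integers with |s| < m/2 and |r| < m/2. If ρ^{s}(b₁) = ρ^{−r}(b₂) and ρ^{−s}(b₁) = ρ^{r}(b₂), then s = −r and b₁ = b₂. -/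
/-- The bi-infinite periodic sequence obtained by repeating a list of integers. -/
def List.periodicExtension (l : List ℤ) (n : ℤ) : ℤ :=
  l.getD (n % (l.length : ℤ)).toNat 0

namespace List

theorem periodic_periodicExtension (l : List ℤ) :
    Function.Periodic l.periodicExtension (l.length : ℤ) := by
  intro n
  simp [periodicExtension]

theorem sum_eq_sum_periodicExtension (l : List ℤ) :
    l.sum = ∑ i ∈ Finset.range l.length, l.periodicExtension i := by
  rw [← Fin.sum_univ_getElem, Finset.sum_range]
  refine Finset.sum_congr rfl fun i _ => ?_
  rw [periodicExtension, Int.emod_eq_of_lt (by positivity) (by exact_mod_cast i.2),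
    Int.toNat_natCast, getD_eq_getElem _ _ i.2]

theorem periodicExtension_zrot {l : List ℤ} (hl : l ≠ []) (t n : ℤ) :
    (zrot l t).periodicExtension n = l.periodicExtension (n + t) := by
  have hm : 0 < l.length := length_pos_of_ne_nil hl
  have hm' : (0 : ℤ) < l.length := by exact_mod_cast hm
  have hn := Int.emod_nonneg n hm'.ne'
  have ht := Int.emod_nonneg t hm'.ne'
  have hlt : (n % (l.length : ℤ)).toNat < l.length := by
    have := Int.emod_lt_of_pos n hm'
    omega
  have hidx : ((n % (l.length : ℤ)).toNat + (t % (l.length : ℤ)).toNat) % l.length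
      = ((n + t) % (l.length : ℤ)).toNat := by
    zify
    rw [Int.toNat_of_nonneg hn, Int.toNat_of_nonneg ht,
      Int.toNat_of_nonneg (Int.emod_nonneg _ hm'.ne'), ← Int.add_emod]
  simp only [periodicExtension, zrot, length_rotate]
  rw [getD_eq_getElem?_getD, getElem?_rotate hlt, hidx, ← getD_eq_getElem?_getD]

end List

theorem Function.Periodic.sum_range_mul {f : ℤ → ℤ} {g : ℕ} (hf : Function.Periodic f g)
    (k : ℕ) : ∑ i ∈ Finset.range (g * k), f i = k * ∑ i ∈ Finset.range g, f i := by
  induction k with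
  | zero => simp
  | succ k ih =>
    rw [Nat.mul_succ, Finset.sum_range_add, ih]
    have h : ∀ i ∈ Finset.range g, f ((g * k + i : ℕ) : ℤ) = f i := fun i _ => by
      have := hf.nat_mul k i
      rw [← this]
      congr 1
      push_cast
      ring
    rw [Finset.sum_congr rfl h]
    push_cast
    ring

theorem Function.Periodic.gcd {f : ℤ → ℤ} {a b : ℤ} (ha : Function.Periodic f a)
    (hb : Function.Periodic f b) : Function.Periodic f (Int.gcd a b : ℤ) := by
  rw [Int.gcd_eq_gcd_ab, mul_comm a, mul_comm b]
  exact (ha.int_mul _).add_period (hb.int_mul _)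

/-- A period of the repetition of a list with sum `±1` is a multiple of its length. -/
theorem List.length_dvd_of_periodic {l : List ℤ} (hsum : IsUnit l.sum) {d : ℤ}
    (hd : Function.Periodic l.periodicExtension d) : (l.length : ℤ) ∣ d := by
  have hg := l.periodic_periodicExtension.gcd hd
  obtain ⟨k, hk⟩ : Int.gcd l.length d ∣ l.length := by
    exact_mod_cast Int.gcd_dvd_left (l.length : ℤ) d
  have hu := hsum
  rw [l.sum_eq_sum_periodicExtension, hk, hg.sum_range_mul] at hu
  have hk1 : k = 1 := Int.ofNat_isUnit.mp (isUnit_of_mul_isUnit_left hu) |> Nat.isUnit_iff.mp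
  rw [hk1, mul_one] at hk
  rw [hk]
  exact Int.gcd_dvd_right _ _

/-- For words `b₁, b₂ ∈ 𝔓₂` of the same odd length `m` with `Σ(b₁) = ±1`, and
`|s|, |r| < m/2`: if `ρ^s(b₁) = ρ^{−r}(b₂)` and `ρ^{−s}(b₁) = ρ^r(b₂)`, then
`s = −r` and `b₁ = b₂`. -/
theorem stmt4 (b₁ b₂ : List ℤ)
    (hw₁ : ∀ v ∈ b₁, v = 1 ∨ v = -1) (hw₂ : ∀ v ∈ b₂, v = 1 ∨ v = -1)
    (hlen : b₂.length = b₁.length) (hodd : Odd b₁.length)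
    (hs₁ : b₁.sum = 1 ∨ b₁.sum = -1)
    (s r : ℤ) (hs : 2 * |s| < (b₁.length : ℤ)) (hr : 2 * |r| < (b₁.length : ℤ))
    (h1 : zrot b₁ s = zrot b₂ (-r)) (h2 : zrot b₁ (-s) = zrot b₂ r) :
    s = -r ∧ b₁ = b₂ := by
  have hb₁ : b₁ ≠ [] := List.ne_nil_of_length_pos hodd.pos
  have hb₂ : b₂ ≠ [] := List.ne_nil_of_length_pos (hlen ▸ hodd.pos)
  have hper : Function.Periodic b₁.periodicExtension (2 * (s + r)) := by
    intro n
    have e1 := congrArg (fun l => l.periodicExtension (n + s + 2 * r)) h1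
    have e2 := congrArg (fun l => l.periodicExtension (n + s)) h2
    simp only [List.periodicExtension_zrot hb₁, List.periodicExtension_zrot hb₂] at e1 e2
    ring_nf at e1 e2 ⊢
    rw [e1, e2]
  have hdvd : (b₁.length : ℤ) ∣ s + r := by
    have hcop : IsCoprime (b₁.length : ℤ) 2 := by
      exact_mod_cast Nat.isCoprime_iff_coprime.mpr hodd.coprime_two_right
    exact hcop.dvd_of_dvd_mul_left
      (List.length_dvd_of_periodic (Int.isUnit_iff.mpr hs₁) hper)
  have hsr : s + r = 0 := by
    refine Int.eq_zero_of_abs_lt_dvd hdvd ?_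
    have := abs_add_le s r
    omega
  obtain rfl : s = -r := by omega
  refine ⟨rfl, ?_⟩
  rw [zrot, zrot, hlen] at h1
  exact List.rotate_injective _ h1
end

section
/- Let b, c ∈ 𝔓₂ be words of the same odd length m with Σ(c) = ±1, and let s, r be integers with |s| < m/2 and |r| < m/2. Then it is impossible that both ρ^{s}(b) = −J(ρ^{−r}(c)) and ρ^{−s}(b) = ρ^{r}(c) hold. -/
theorem sum_zrot (l : List ℤ) (t : ℤ) : (zrot l t).sum = l.sum :=
  (l.rotate_perm _).sum_eq

theorem sum_map_neg_reverse (l : List ℤ) : (l.reverse.map (fun v => -v)).sum = -l.sum := by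
  rw [← l.sum_reverse, List.sum_neg]

/-- For words `b, c ∈ 𝔓₂` of the same odd length `m` with `Σ(c) = ±1`, and
`|s|, |r| < m/2`, it is impossible that both `ρ^s(b) = −J(ρ^{−r}(c))` and
`ρ^{−s}(b) = ρ^r(c)` hold. -/
theorem stmt5 (b c : List ℤ)
    (hwb : ∀ v ∈ b, v = 1 ∨ v = -1) (hwc : ∀ v ∈ c, v = 1 ∨ v = -1)
    (hlen : c.length = b.length) (hodd : Odd b.length)
    (hsc : c.sum = 1 ∨ c.sum = -1)
    (s r : ℤ) (hs : 2 * |s| < (b.length : ℤ)) (hr : 2 * |r| < (b.length : ℤ)) :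
    ¬ (zrot b s = (zrot c (-r)).reverse.map (fun v => -v) ∧
       zrot b (-s) = zrot c r) := by
  rintro ⟨h₁, h₂⟩
  have e₁ := congrArg List.sum h₁
  have e₂ := congrArg List.sum h₂
  rw [sum_map_neg_reverse, sum_zrot, sum_zrot] at e₁
  rw [sum_zrot, sum_zrot] at e₂
  omega
end
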